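/- Let A be a unital C*-algebra and d ≥ 1, with data (w_{i,k}), (u_j), (m_i), (n_j), (c_i), r_k, θ₁ as in the context, and ρ ≥ 0 with ‖r_k‖ ≤ ρ for all k. Let x = Σ_{j∈F} d_j u_j and y = Σ_{j∈F'} e_j u_j (F, F' ⊆ J finite), with constants c_x, c_y ≥ 1 satisfying Σ_{j∈F} |d_j| n_j^m ≤ c_x^m and Σ_{j∈F'} |e_j| n_j^m ≤ c_y^m for all m ≥ 1, and set c_{x,y} := max(c_x, c_y). Then for all integers m₁, m₂ ≥ 1, n ≥ 1, all fixed tuples ε̄' ∈ {−1,0,+1}^{m₁}, ε̄'' ∈ {−1,0,+1}^{m₂} and every ε̄ ∈ {−1,0,+1}^n, the sum over all tuples k̄ ∈ (ℤ^d)^n, k̄' ∈ (ℤ^d)^{m₁}, k̄'' ∈ (ℤ^d)^{m₂} of ‖δ(k̄,ε̄)( δ(k̄',ε̄')(x) · δ(k̄'',ε̄'')(y) )‖ is at most 2^n·(1+ρ)^{2n+m₁+m₂}·(2·θ₁·c_{x,y})^{n+m₁+m₂}, where δ(k̄,ε̄) denotes the composition δ^{ε_n}_{k_n} ∘ ⋯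 ∘ δ^{ε₁}_{k₁}. -/

import Mathlib

open scoped BigOperators

/-- Iterated application of the (signed) derivations
`δ_k(a) = a r_k - r_k a` (sign `+1`), `δ†_k(a) = r_k* a - a r_k*` (sign `-1`),
and the Lindblad map `ℒ_k(a) = (1/2)(δ†_k(a) r_k + r_k* δ_k(a))` (sign `0`),
applied first with index `0` (innermost) and last with index `n-1` (outermost). -/
noncomputable def deltaIter {A K : Type*} [Ring A] [StarRing A] [Module ℂ A]
    (r : K → A) {n : ℕ} (ε : Fin n → ℤ) (k : Fin n → K) (x : A) : A :=
  (List.ofFn fun l : Fin n => fun a : A =>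
    if ε l = 1 then a * r (k l) - r (k l) * a
    else if ε l = -1 then star (r (k l)) * a - a * star (r (k l))
    else (2 : ℂ)⁻¹ • ((star (r (k l)) * a - a * star (r (k l))) * r (k l)
          + star (r (k l)) * (a * r (k l) - r (k l) * a))).foldl (fun a f => f a) x

/-- One step of `deltaIter`, as a linear map. -/
noncomputable def deltaStep {A : Type*} [Ring A] [StarRing A] [Algebra ℂ A] (e : ℤ) (r : A) :
    A →ₗ[ℂ] A :=
  if e = 1 then LinearMap.mulRight ℂ r - LinearMap.mulLeft ℂ r
  else if e = -1 then LinearMap.mulLeft ℂ (star r) - LinearMap.mulRight ℂ (star r)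
  else (2 : ℂ)⁻¹ •
    (LinearMap.mulRight ℂ r ∘ₗ (LinearMap.mulLeft ℂ (star r) - LinearMap.mulRight ℂ (star r))
      + LinearMap.mulLeft ℂ (star r) ∘ₗ (LinearMap.mulRight ℂ r - LinearMap.mulLeft ℂ r))

/-- The element `a` commutes with `w i k` and its adjoint whenever `k ∉ S i`. -/
def CommutesOff {A I K : Type*} [Mul A] [Star A] (w : I → K → A) (S : I → Set K) (a : A) : Prop :=
  ∀ i k, k ∉ S i → Commute (w i k) a ∧ Commute (star (w i k)) a

/-- The total weight of the indices `i` with `k ∈ S i`. -/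
noncomputable def localWeight {I K : Type*} (γ : I → ℝ) (S : I → Set K) (k : K) : ℝ :=
  ∑' i, {i | k ∈ S i}.indicator γ i

section LocalWeight

variable {I K : Type*} {γ : I → ℝ} {S S' : I → Set K}

lemma localWeight_nonneg (hγ : ∀ i, 0 ≤ γ i) (k : K) : 0 ≤ localWeight γ S k :=
  tsum_nonneg fun i => Set.indicator_nonneg (fun i _ => hγ i) i

lemma localWeight_union_le (hγ : ∀ i, 0 ≤ γ i) (hs : Summable γ) (k : K) :
    localWeight γ (fun i => S i ∪ S' i) k ≤ localWeight γ S k + localWeight γ S' k := by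
  classical
  unfold localWeight
  rw [← (hs.indicator _).tsum_add (hs.indicator _)]
  refine (hs.indicator _).tsum_le_tsum (fun i => ?_) ((hs.indicator _).add (hs.indicator _))
  have := hγ i
  simp only [Set.indicator_apply, Set.mem_ofPred_eq, Set.mem_union]
  split_ifs <;> first | tauto | linarith

lemma sum_localWeight_le (hγ : ∀ i, 0 ≤ γ i) (hs : Summable γ) {m : I → ℝ} {θ ν : ℝ}
    (hθ : HasSum (fun i => γ i * m i) θ)
    (hS : ∀ i, (S i).Finite ∧ ((S i).ncard : ℝ) ≤ m i * ν) (T : Finset K) :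
    ∑ k ∈ T, localWeight γ S k ≤ θ * ν := by
  classical
  unfold localWeight
  rw [← Summable.tsum_finsetSum fun k _ => hs.indicator _]
  refine (Summable.tsum_le_tsum (fun i => ?_) (summable_sum fun k _ => hs.indicator _)
    (hθ.mul_right ν).summable).trans_eq (hθ.mul_right ν).tsum_eq
  have hcard : ((T.filter (· ∈ S i)).card : ℝ) ≤ m i * ν := by
    refine le_trans ?_ (hS i).2
    rw [← Set.ncard_coe_finset]
    exact_mod_cast Set.ncard_le_ncard (fun k hk => (Finset.mem_filter.1 hk).2) (hS i).1
  calc ∑ k ∈ T, {i | k ∈ S i}.indicator γ i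
      = (T.filter (· ∈ S i)).card * γ i := by
        simp [Set.indicator_apply, ← Finset.sum_filter]
    _ ≤ (m i * ν) * γ i := mul_le_mul_of_nonneg_right hcard (hγ i)
    _ = γ i * m i * ν := by ring

end LocalWeight

section Algebraic

variable {A I K : Type*} [Ring A] [StarRing A]

lemma CommutesOff.mul {w : I → K → A} {S S' : I → Set K} {a b : A}
    (ha : CommutesOff w S a) (hb : CommutesOff w S' b) :
    CommutesOff w (fun i => S i ∪ S' i) (a * b) := fun i k hk => by
  have hk' := not_or.1 hk
  exact ⟨(ha i k hk'.1).1.mul_right (hb i k hk'.2).1,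
    (ha i k hk'.1).2.mul_right (hb i k hk'.2).2⟩

variable [Algebra ℂ A]

lemma commute_star_smul {a v : A} (c : ℂ) (h : Commute a (star v)) :
    Commute a (star (c • v)) := by
  rw [← smul_one_mul c v, star_mul]
  refine h.mul_right ?_
  have h1 : Commute (star a) (c • (1 : A)) := (Commute.one_right _).smul_right c
  simpa using h1.star_star

lemma deltaStep_apply (e : ℤ) (r a : A) :
    deltaStep e r a = if e = 1 then a * r - r * a
      else if e = -1 then star r * a - a * star r
      else (2 : ℂ)⁻¹ • ((star r * a - a * star r) * r + star r * (a * r - r * a)) := by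
  unfold deltaStep
  split_ifs <;> simp

lemma commute_deltaStep {v r a : A} (e : ℤ) (hr : Commute v r) (hr' : Commute v (star r))
    (ha : Commute v a) : Commute v (deltaStep e r a) := by
  have h1 : Commute v (a * r - r * a) := (ha.mul_right hr).sub_right (hr.mul_right ha)
  have h2 : Commute v (star r * a - a * star r) :=
    (hr'.mul_right ha).sub_right (ha.mul_right hr')
  rw [deltaStep_apply]
  split_ifs
  · exact h1
  · exact h2
  · exact ((h2.mul_right hr).add_right (hr'.mul_right h1)).smul_right _

lemma deltaIter_zero (r : K → A) (ε : Fin 0 → ℤ) (k : Fin 0 → K) (x : A) :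
    deltaIter r ε k x = x := by
  simp [deltaIter]

lemma deltaIter_succ (r : K → A) {n : ℕ} (ε : Fin (n + 1) → ℤ) (k : Fin (n + 1) → K) (x : A) :
    deltaIter r ε k x =
      deltaIter r (fun l => ε l.succ) (fun l => k l.succ) (deltaStep (ε 0) (r (k 0)) x) := by
  simp only [deltaIter, List.ofFn_succ, List.foldl_cons, deltaStep_apply]

lemma exists_linearMap_deltaIter (r : K → A) {n : ℕ} (ε : Fin n → ℤ) (k : Fin n → K) :
    ∃ L : A →ₗ[ℂ] A, ∀ x, deltaIter r ε k x = L x := by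
  induction n with
  | zero => exact ⟨LinearMap.id, fun x => deltaIter_zero r ε k x⟩
  | succ n ih =>
    obtain ⟨L, hL⟩ := ih (fun l => ε l.succ) (fun l => k l.succ)
    exact ⟨L ∘ₗ deltaStep (ε 0) (r (k 0)), fun x => by rw [deltaIter_succ, hL]; rfl⟩

lemma deltaIter_sum_smul (r : K → A) {n : ℕ} (ε : Fin n → ℤ) (k : Fin n → K)
    {J : Type*} (F : Finset J) (c : J → ℂ) (u : J → A) :
    deltaIter r ε k (∑ j ∈ F, c j • u j) = ∑ j ∈ F, c j • deltaIter r ε k (u j) := by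
  obtain ⟨L, hL⟩ := exists_linearMap_deltaIter r ε k
  simp [hL]

end Algebraic

section Analytic

variable {A I K : Type*} [NormedRing A]

lemma norm_commutator_le_tsum_indicator {f : I → A} {γ : I → ℝ} {r a : A} {s : Set I}
    (hf : HasSum f r) (hfγ : ∀ i, ‖f i‖ ≤ γ i) (hγ : Summable γ)
    (hs : ∀ i ∉ s, Commute (f i) a) :
    ‖a * r - r * a‖ ≤ 2 * (∑' i, s.indicator γ i) * ‖a‖ := by
  have h1 : HasSum (fun i => a * f i - f i * a) (a * r - r * a) :=
    (hf.mul_left a).sub (hf.mul_right a)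
  refine HasSum.norm_le_of_bounded h1 (((hγ.indicator s).hasSum.mul_left 2).mul_right ‖a‖)
    fun i => ?_
  by_cases hi : i ∈ s
  · rw [Set.indicator_of_mem hi]
    calc ‖a * f i - f i * a‖ ≤ ‖a‖ * ‖f i‖ + ‖f i‖ * ‖a‖ :=
          (norm_sub_le _ _).trans (add_le_add (norm_mul_le _ _) (norm_mul_le _ _))
      _ = 2 * ‖f i‖ * ‖a‖ := by ring
      _ ≤ 2 * γ i * ‖a‖ := by gcongr; exact hfγ i
  · simp [Set.indicator_of_notMem hi, (hs i hi).eq]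

variable [StarRing A] [CStarRing A] [NormedAlgebra ℂ A]

lemma norm_deltaStep_le (e : ℤ) {r a : A} {ρ β : ℝ} (hr : ‖r‖ ≤ ρ)
    (h1 : ‖a * r - r * a‖ ≤ 2 * β * ‖a‖) (h2 : ‖a * star r - star r * a‖ ≤ 2 * β * ‖a‖) :
    ‖deltaStep e r a‖ ≤ 2 * (1 + ρ) * β * ‖a‖ := by
  have hρ : 0 ≤ ρ := (norm_nonneg r).trans hr
  have hb : 0 ≤ 2 * β * ‖a‖ := (norm_nonneg _).trans h1
  have hmul : 0 ≤ ρ * (2 * β * ‖a‖) := mul_nonneg hρ hb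
  rw [norm_sub_rev] at h2
  rw [deltaStep_apply]
  split_ifs
  · linarith
  · linarith
  · have h3 : ‖(star r * a - a * star r) * r‖ ≤ (2 * β * ‖a‖) * ρ :=
      (norm_mul_le _ _).trans (by gcongr)
    have h4 : ‖star r * (a * r - r * a)‖ ≤ ρ * (2 * β * ‖a‖) :=
      (norm_mul_le _ _).trans (by rw [norm_star]; gcongr)
    rw [norm_smul]
    have h5 := norm_add_le ((star r * a - a * star r) * r) (star r * (a * r - r * a))
    have h6 : ‖(2 : ℂ)⁻¹‖ = 2⁻¹ := by simp
    rw [h6]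
    linarith

variable {w : I → K → A} {c : I → ℂ} {r : K → A} {ρ : ℝ} {S : I → Set K} {a : A}

/-- Iterated derivations are controlled pointwise by products of local weights, and they preserve
commutation with the `w i k`. -/
lemma norm_deltaIter_le_and_commutesOff (hwnorm : ∀ i k, ‖w i k‖ ≤ 1)
    (hwcomm : ∀ i k i' k', Commute (w i k) (w i' k'))
    (hwcommstar : ∀ i k i' k', Commute (star (w i k)) (w i' k'))
    (hc : Summable fun i => ‖c i‖) (hr : ∀ k, HasSum (fun i => c i • w i k) (r k))
    (hrnorm : ∀ k, ‖r k‖ ≤ ρ) {n : ℕ} (ε : Fin n → ℤ) (k : Fin n → K)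
    (ha : CommutesOff w S a) :
    ‖deltaIter r ε k a‖ ≤
        (∏ l, 2 * (1 + ρ) * localWeight (fun i => ‖c i‖) S (k l)) * ‖a‖ ∧
      CommutesOff w S (deltaIter r ε k a) := by
  have hwr : ∀ i k k', Commute (w i k) (r k') := fun i k k' => by
    rw [← (hr k').tsum_eq]
    exact Commute.tsum_right _ fun i' => (hwcomm i k i' k').smul_right _
  have hswr : ∀ i k k', Commute (star (w i k)) (r k') := fun i k k' => by
    rw [← (hr k').tsum_eq]
    exact Commute.tsum_right _ fun i' => (hwcommstar i k i' k').smul_right _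
  have hcw : ∀ i k, ‖c i • w i k‖ ≤ ‖c i‖ := fun i k => by
    rw [norm_smul]
    exact mul_le_of_le_one_right (norm_nonneg _) (hwnorm i k)
  induction n generalizing a with
  | zero => simpa [deltaIter_zero] using ha
  | succ n ih =>
    have hstep : CommutesOff w S (deltaStep (ε 0) (r (k 0)) a) := fun i k' hk' =>
      ⟨commute_deltaStep _ (hwr _ _ _) (by simpa using (hswr i k' (k 0)).star_star) (ha i k' hk').1,
        commute_deltaStep _ (hswr _ _ _) (hwr i k' (k 0)).star_star (ha i k' hk').2⟩
    have hnorm : ‖deltaStep (ε 0) (r (k 0)) a‖ ≤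
        2 * (1 + ρ) * localWeight (fun i => ‖c i‖) S (k 0) * ‖a‖ := by
      refine norm_deltaStep_le _ (hrnorm _) ?_ ?_
      · exact norm_commutator_le_tsum_indicator (hr (k 0)) (fun i => hcw i _) hc
          fun i hi => (ha i (k 0) hi).1.smul_left _
      · refine norm_commutator_le_tsum_indicator (hr (k 0)).star
          (fun i => (norm_star _).trans_le (hcw i _)) hc fun i hi => ?_
        exact (commute_star_smul _ (ha i (k 0) hi).2.symm).symm
    obtain ⟨h1, h2⟩ := ih (fun l => ε l.succ) (fun l => k l.succ) hstep
    have hρ : 0 ≤ ρ := (norm_nonneg _).trans (hrnorm (k 0))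
    rw [deltaIter_succ]
    refine ⟨h1.trans ?_, h2⟩
    rw [Fin.prod_univ_succ, mul_comm (2 * (1 + ρ) * localWeight _ S (k 0)), mul_assoc]
    refine mul_le_mul_of_nonneg_left hnorm (Finset.prod_nonneg fun l _ => ?_)
    have := localWeight_nonneg (S := S) (fun i => norm_nonneg (c i)) (k l.succ)
    positivity

/-- Pointwise bound for iterated derivations of a product of iterated derivations. -/
lemma norm_deltaIter_mul_le (hwnorm : ∀ i k, ‖w i k‖ ≤ 1)
    (hwcomm : ∀ i k i' k', Commute (w i k) (w i' k'))
    (hwcommstar : ∀ i k i' k', Commute (star (w i k)) (w i' k'))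
    (hc : Summable fun i => ‖c i‖) (hr : ∀ k, HasSum (fun i => c i • w i k) (r k))
    (hρ : 0 ≤ ρ) (hrnorm : ∀ k, ‖r k‖ ≤ ρ) {S' : I → Set K} {b : A}
    (ha : CommutesOff w S a) (hb : CommutesOff w S' b) (ha1 : ‖a‖ ≤ 1) (hb1 : ‖b‖ ≤ 1)
    {n m₁ m₂ : ℕ} (ε : Fin n → ℤ) (ε' : Fin m₁ → ℤ) (ε'' : Fin m₂ → ℤ)
    (k : Fin n → K) (k' : Fin m₁ → K) (k'' : Fin m₂ → K) :
    ‖deltaIter r ε k (deltaIter r ε' k' a * deltaIter r ε'' k'' b)‖ ≤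
      (∏ l, (2 * (1 + ρ) * localWeight (fun i => ‖c i‖) S (k l)
          + 2 * (1 + ρ) * localWeight (fun i => ‖c i‖) S' (k l))) *
        ((∏ l, 2 * (1 + ρ) * localWeight (fun i => ‖c i‖) S (k' l)) *
          ∏ l, 2 * (1 + ρ) * localWeight (fun i => ‖c i‖) S' (k'' l)) := by
  obtain ⟨h1, h1'⟩ := norm_deltaIter_le_and_commutesOff hwnorm hwcomm hwcommstar hc hr hrnorm
    ε' k' ha
  obtain ⟨h2, h2'⟩ := norm_deltaIter_le_and_commutesOff hwnorm hwcomm hwcommstar hc hr hrnorm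
    ε'' k'' hb
  have hγ : ∀ i, 0 ≤ ‖c i‖ := fun i => norm_nonneg _
  have hβ : ∀ (S : I → Set K) k, 0 ≤ 2 * (1 + ρ) * localWeight (fun i => ‖c i‖) S k :=
    fun S k => mul_nonneg (by positivity) (localWeight_nonneg hγ k)
  have hP : ∀ (S : I → Set K) {N : ℕ} (k : Fin N → K),
      0 ≤ ∏ l, 2 * (1 + ρ) * localWeight (fun i => ‖c i‖) S (k l) :=
    fun S N k => Finset.prod_nonneg fun l _ => hβ S (k l)
  refine (norm_deltaIter_le_and_commutesOff hwnorm hwcomm hwcommstar hc hr hrnorm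
    ε k (h1'.mul h2')).1.trans ?_
  have h3 := h1.trans (mul_le_of_le_one_right (hP S k') ha1)
  have h4 := h2.trans (mul_le_of_le_one_right (hP S' k'') hb1)
  have h5 := (norm_mul_le (deltaIter r ε' k' a) (deltaIter r ε'' k'' b)).trans
    (mul_le_mul h3 h4 (norm_nonneg _) (hP S k'))
  refine mul_le_mul (Finset.prod_le_prod (fun l _ => hβ _ _) fun l _ => ?_) h5 (norm_nonneg _)
    (Finset.prod_nonneg fun l _ => ?_)
  · rw [← mul_add]
    exact mul_le_mul_of_nonneg_left (localWeight_union_le hγ hc _) (by positivity)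
  · exact add_nonneg (hβ _ _) (hβ _ _)

end Analytic

lemma sum_sum_mul_add_pow_le {J : Type*} {F F' : Finset J} {p q ν : J → ℝ} {cx cy : ℝ}
    (hq : ∀ j, 0 ≤ q j) (hν : ∀ j, 0 ≤ ν j) (hcx0 : 0 ≤ cx)
    (hcx : ∀ M : ℕ, 1 ≤ M → ∑ j ∈ F, p j * ν j ^ M ≤ cx ^ M)
    (hcy : ∀ M : ℕ, 1 ≤ M → ∑ j ∈ F', q j * ν j ^ M ≤ cy ^ M)
    {m₁ m₂ : ℕ} (n : ℕ) (hm₁ : 1 ≤ m₁) (hm₂ : 1 ≤ m₂) :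
    ∑ j ∈ F, ∑ l ∈ F', p j * q l * ((ν j + ν l) ^ n * (ν j ^ m₁ * ν l ^ m₂)) ≤
      (cx + cy) ^ n * (cx ^ m₁ * cy ^ m₂) := by
  have hexp : ∑ j ∈ F, ∑ l ∈ F', p j * q l * ((ν j + ν l) ^ n * (ν j ^ m₁ * ν l ^ m₂)) =
      ∑ t ∈ Finset.range (n + 1), (∑ j ∈ F, p j * ν j ^ (t + m₁)) *
        (∑ l ∈ F', q l * ν l ^ (n - t + m₂)) * (n.choose t : ℝ) := by
    simp_rw [Finset.sum_mul_sum, Finset.sum_mul]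
    rw [Finset.sum_comm]
    rw [Finset.sum_comm (s := Finset.range (n + 1))]
    rw [Finset.sum_comm]
    refine Finset.sum_congr rfl fun j _ => ?_
    rw [Finset.sum_comm]
    refine Finset.sum_congr rfl fun l _ => ?_
    rw [add_pow, Finset.sum_mul, Finset.mul_sum]
    refine Finset.sum_congr rfl fun t _ => ?_
    ring
  rw [hexp, add_pow, Finset.sum_mul]
  refine Finset.sum_le_sum fun t _ => ?_
  calc _ ≤ cx ^ (t + m₁) * cy ^ (n - t + m₂) * (n.choose t : ℝ) := by
        gcongr
        · exact Finset.sum_nonneg fun l _ => mul_nonneg (hq l) (pow_nonneg (hν l) _)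
        · exact hcx _ (by omega)
        · exact hcy _ (by omega)
    _ = _ := by ring

/-- A sum over triples of tuples of a product of one-variable factors, each with bounded sum. -/
lemma sum_piFinset_prod_le {K : Type*} [DecidableEq K] (T : Finset K) {f g h : K → ℝ}
    (hf : ∀ k, 0 ≤ f k) (hg : ∀ k, 0 ≤ g k) (hh : ∀ k, 0 ≤ h k) {a b c : ℝ}
    (ha : ∑ k ∈ T, f k ≤ a) (hb : ∑ k ∈ T, g k ≤ b) (hc : ∑ k ∈ T, h k ≤ c) (n m₁ m₂ : ℕ) :
    ∑ kk ∈ (Fintype.piFinset fun _ : Fin n => T) ×ˢ (Fintype.piFinset fun _ : Fin m₁ => T) ×ˢ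
        (Fintype.piFinset fun _ : Fin m₂ => T),
      (∏ l, f (kk.1 l)) * ((∏ l, g (kk.2.1 l)) * ∏ l, h (kk.2.2 l)) ≤
      a ^ n * (b ^ m₁ * c ^ m₂) := by
  have hprod : ∀ (f : K → ℝ) (n : ℕ),
      ∑ k ∈ Fintype.piFinset fun _ : Fin n => T, ∏ l, f (k l) = (∑ k ∈ T, f k) ^ n := by
    intro f n
    rw [← Finset.prod_univ_sum]
    simp
  have hf' := Finset.sum_nonneg fun k (_ : k ∈ T) => hf k
  have hg' := Finset.sum_nonneg fun k (_ : k ∈ T) => hg k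
  have hh' := Finset.sum_nonneg fun k (_ : k ∈ T) => hh k
  simp_rw [Finset.sum_product, ← Finset.mul_sum, ← Finset.sum_mul, hprod]
  have := hg'.trans hb
  have := hf'.trans ha
  gcongr

lemma sum_piFinset_sum_sum_prod_le {J K : Type*} [DecidableEq K] (T : Finset K)
    {F F' : Finset J} {p q ν : J → ℝ} {β : J → K → ℝ} {κ cx cy : ℝ}
    (hp : ∀ j, 0 ≤ p j) (hq : ∀ j, 0 ≤ q j) (hν : ∀ j, 0 ≤ ν j) (hβ : ∀ j k, 0 ≤ β j k)
    (hκ : 0 ≤ κ) (hcx0 : 0 ≤ cx) (hβsum : ∀ j, ∑ k ∈ T, β j k ≤ κ * ν j)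
    (hcx : ∀ M : ℕ, 1 ≤ M → ∑ j ∈ F, p j * ν j ^ M ≤ cx ^ M)
    (hcy : ∀ M : ℕ, 1 ≤ M → ∑ j ∈ F', q j * ν j ^ M ≤ cy ^ M)
    {m₁ m₂ : ℕ} (n : ℕ) (hm₁ : 1 ≤ m₁) (hm₂ : 1 ≤ m₂) :
    ∑ kk ∈ (Fintype.piFinset fun _ : Fin n => T) ×ˢ (Fintype.piFinset fun _ : Fin m₁ => T) ×ˢ
        (Fintype.piFinset fun _ : Fin m₂ => T),
      ∑ j ∈ F, ∑ l ∈ F', p j * q l * ((∏ t, (β j (kk.1 t) + β l (kk.1 t))) *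
        ((∏ t, β j (kk.2.1 t)) * ∏ t, β l (kk.2.2 t))) ≤
      κ ^ (n + m₁ + m₂) * ((cx + cy) ^ n * (cx ^ m₁ * cy ^ m₂)) := by
  calc _ ≤ ∑ j ∈ F, ∑ l ∈ F', p j * q l *
          ((κ * ν j + κ * ν l) ^ n * ((κ * ν j) ^ m₁ * (κ * ν l) ^ m₂)) := by
        rw [Finset.sum_comm]
        refine Finset.sum_le_sum fun j _ => ?_
        rw [Finset.sum_comm]
        refine Finset.sum_le_sum fun l _ => ?_
        rw [← Finset.mul_sum]
        refine mul_le_mul_of_nonneg_left (sum_piFinset_prod_le T (f := fun k => β j k + β l k)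
          (fun k => add_nonneg (hβ j k) (hβ l k)) (hβ j) (hβ l) ?_ (hβsum j) (hβsum l) n m₁ m₂)
          (mul_nonneg (hp j) (hq l))
        rw [Finset.sum_add_distrib]
        exact add_le_add (hβsum j) (hβsum l)
    _ = κ ^ (n + m₁ + m₂) * ∑ j ∈ F, ∑ l ∈ F', p j * q l *
          ((ν j + ν l) ^ n * (ν j ^ m₁ * ν l ^ m₂)) := by
        simp_rw [Finset.mul_sum]
        refine Finset.sum_congr rfl fun j _ => Finset.sum_congr rfl fun l _ => ?_
        rw [← mul_add, mul_pow κ]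
        ring
    _ ≤ _ := mul_le_mul_of_nonneg_left
        (sum_sum_mul_add_pow_le hq hν hcx0 hcx hcy n hm₁ hm₂) (by positivity)

/-- Lemma 3.1(iv): for fixed sign tuples `ε̄' ∈ {-1,0,1}^{m₁}`, `ε̄'' ∈ {-1,0,1}^{m₂}` and any
`ε̄ ∈ {-1,0,1}^n`, the sum over all tuples `k̄, k̄', k̄''` of
`‖δ(k̄,ε̄)(δ(k̄',ε̄')(x) · δ(k̄'',ε̄'')(y))‖` is at most
`2^n (1+ρ)^{2n+m₁+m₂} (2 θ₁ c_{x,y})^{n+m₁+m₂}` with `c_{x,y} = max(c_x, c_y)`. -/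
theorem lemma31iv
    {A : Type*} [NormedRing A] [StarRing A] [CStarRing A] [NormedAlgebra ℂ A]
    [CompleteSpace A]
    {I J : Type*} [Countable I]
    (d : ℕ) (hd : 1 ≤ d)
    (w : I → (Fin d → ℤ) → A) (hwnorm : ∀ i k, ‖w i k‖ ≤ 1)
    (hwcomm : ∀ i k i' k', Commute (w i k) (w i' k'))
    (hwcommstar : ∀ i k i' k', Commute (star (w i k)) (w i' k'))
    (u : J → A) (hunorm : ∀ j, ‖u j‖ ≤ 1)
    (m : I → ℝ) (hm : ∀ i, 0 ≤ m i) (ν : J → ℝ) (hν : ∀ j, 0 ≤ ν j)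
    (hfin : ∀ i j,
      ({k : Fin d → ℤ | w i k * u j ≠ u j * w i k ∨
          star (w i k) * u j ≠ u j * star (w i k)}).Finite ∧
        (({k : Fin d → ℤ | w i k * u j ≠ u j * w i k ∨
            star (w i k) * u j ≠ u j * star (w i k)}).ncard : ℝ) ≤ m i * ν j)
    (c : I → ℂ) (hc : Summable fun i => ‖c i‖)
    (θ₁ : ℝ) (hθ : HasSum (fun i => ‖c i‖ * m i) θ₁)
    (r : (Fin d → ℤ) → A) (hr : ∀ k, HasSum (fun i => c i • w i k) (r k))
    (ρ : ℝ) (hρ : 0 ≤ ρ) (hrnorm : ∀ k, ‖r k‖ ≤ ρ)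
    (F F' : Finset J) (dcoef ecoef : J → ℂ)
    (x y : A) (hx : x = ∑ j ∈ F, dcoef j • u j) (hy : y = ∑ j ∈ F', ecoef j • u j)
    (cx cy : ℝ) (hcx1 : 1 ≤ cx) (hcy1 : 1 ≤ cy)
    (hcx : ∀ M : ℕ, 1 ≤ M → ∑ j ∈ F, ‖dcoef j‖ * ν j ^ M ≤ cx ^ M)
    (hcy : ∀ M : ℕ, 1 ≤ M → ∑ j ∈ F', ‖ecoef j‖ * ν j ^ M ≤ cy ^ M)
    (m₁ m₂ n : ℕ) (hm₁ : 1 ≤ m₁) (hm₂ : 1 ≤ m₂) (hn : 1 ≤ n)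
    (ε' : Fin m₁ → ℤ) (hε' : ∀ l, ε' l = 1 ∨ ε' l = 0 ∨ ε' l = -1)
    (ε'' : Fin m₂ → ℤ) (hε'' : ∀ l, ε'' l = 1 ∨ ε'' l = 0 ∨ ε'' l = -1)
    (ε : Fin n → ℤ) (hε : ∀ l, ε l = 1 ∨ ε l = 0 ∨ ε l = -1) :
    Summable (fun kk : (Fin n → (Fin d → ℤ)) × (Fin m₁ → (Fin d → ℤ)) ×
          (Fin m₂ → (Fin d → ℤ)) =>
        ‖deltaIter r ε kk.1 (deltaIter r ε' kk.2.1 x * deltaIter r ε'' kk.2.2 y)‖) ∧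
      ∑' kk : (Fin n → (Fin d → ℤ)) × (Fin m₁ → (Fin d → ℤ)) × (Fin m₂ → (Fin d → ℤ)),
          ‖deltaIter r ε kk.1 (deltaIter r ε' kk.2.1 x * deltaIter r ε'' kk.2.2 y)‖
        ≤ 2 ^ n * (1 + ρ) ^ (2 * n + m₁ + m₂) * (2 * θ₁ * max cx cy) ^ (n + m₁ + m₂) := by
  classical
  set C := max cx cy with hC
  set S : J → I → Set (Fin d → ℤ) := fun j i => {k | w i k * u j ≠ u j * w i k ∨
    star (w i k) * u j ≠ u j * star (w i k)} with hS
  set β : J → (Fin d → ℤ) → ℝ :=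
    fun j k => 2 * (1 + ρ) * localWeight (fun i => ‖c i‖) (S j) k with hβ
  have hoff : ∀ j, CommutesOff w (S j) (u j) := fun j i k hk => by
    simpa [hS, not_or, Commute, SemiconjBy] using hk
  have hγ : ∀ i, 0 ≤ ‖c i‖ := fun i => norm_nonneg _
  have hβ0 : ∀ j k, 0 ≤ β j k := fun j k =>
    mul_nonneg (by positivity) (localWeight_nonneg hγ k)
  have hθ0 : 0 ≤ θ₁ := hθ.nonneg fun i => mul_nonneg (hγ i) (hm i)
  have hβsum : ∀ (T : Finset (Fin d → ℤ)) j, ∑ k ∈ T, β j k ≤ 2 * (1 + ρ) * θ₁ * ν j :=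
    fun T j => by
      rw [← Finset.mul_sum, mul_assoc _ θ₁]
      exact mul_le_mul_of_nonneg_left (sum_localWeight_le hγ hc hθ (hfin · j) T) (by positivity)
  have hpoint : ∀ kk : (Fin n → (Fin d → ℤ)) × (Fin m₁ → (Fin d → ℤ)) × (Fin m₂ → (Fin d → ℤ)),
      ‖deltaIter r ε kk.1 (deltaIter r ε' kk.2.1 x * deltaIter r ε'' kk.2.2 y)‖ ≤
        ∑ j ∈ F, ∑ l ∈ F', ‖dcoef j‖ * ‖ecoef l‖ *
          ((∏ t, (β j (kk.1 t) + β l (kk.1 t))) *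
            ((∏ t, β j (kk.2.1 t)) * ∏ t, β l (kk.2.2 t))) := by
    intro kk
    obtain ⟨L, hL⟩ := exists_linearMap_deltaIter r ε kk.1
    rw [hx, hy, deltaIter_sum_smul, deltaIter_sum_smul, Finset.sum_mul_sum, hL, map_sum]
    refine norm_sum_le_of_le _ fun j _ => ?_
    rw [map_sum]
    refine norm_sum_le_of_le _ fun l _ => ?_
    rw [smul_mul_smul_comm, map_smul, norm_smul, norm_mul, ← hL]
    exact mul_le_mul_of_nonneg_left
      (norm_deltaIter_mul_le hwnorm hwcomm hwcommstar hc hr hρ hrnorm (hoff j) (hoff l)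
        (hunorm j) (hunorm l) ε ε' ε'' _ _ _) (by positivity)
  have hC0 : 0 ≤ C := by positivity
  have hbound : ∀ s : Finset ((Fin n → (Fin d → ℤ)) × (Fin m₁ → (Fin d → ℤ)) ×
      (Fin m₂ → (Fin d → ℤ))),
      ∑ kk ∈ s, ‖deltaIter r ε kk.1 (deltaIter r ε' kk.2.1 x * deltaIter r ε'' kk.2.2 y)‖ ≤
        2 ^ n * (1 + ρ) ^ (2 * n + m₁ + m₂) * (2 * θ₁ * C) ^ (n + m₁ + m₂) := by
    intro s
    set T : Finset (Fin d → ℤ) := s.biUnion fun kk =>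
      Finset.univ.image kk.1 ∪ Finset.univ.image kk.2.1 ∪ Finset.univ.image kk.2.2 with hT
    have hsT : s ⊆ (Fintype.piFinset fun _ : Fin n => T) ×ˢ
        (Fintype.piFinset fun _ : Fin m₁ => T) ×ˢ (Fintype.piFinset fun _ : Fin m₂ => T) := by
      intro kk hkk
      simp only [Finset.mem_product, Fintype.mem_piFinset, hT, Finset.mem_biUnion,
        Finset.mem_union, Finset.mem_image, Finset.mem_univ, true_and]
      exact ⟨fun t => ⟨kk, hkk, .inl (.inl ⟨t, rfl⟩)⟩, fun t => ⟨kk, hkk, .inl (.inr ⟨t, rfl⟩)⟩,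
        fun t => ⟨kk, hkk, .inr ⟨t, rfl⟩⟩⟩
    calc _ ≤ (2 * (1 + ρ) * θ₁) ^ (n + m₁ + m₂) * ((cx + cy) ^ n * (cx ^ m₁ * cy ^ m₂)) :=
          (Finset.sum_le_sum_of_subset_of_nonneg hsT fun _ _ _ => norm_nonneg _).trans
            ((Finset.sum_le_sum fun kk _ => hpoint kk).trans
              (sum_piFinset_sum_sum_prod_le T (fun _ => norm_nonneg _) (fun _ => norm_nonneg _)
                hν hβ0 (by positivity) (by positivity) (hβsum T) hcx hcy n hm₁ hm₂))
      _ ≤ (2 * (1 + ρ) * θ₁) ^ (n + m₁ + m₂) * ((C + C) ^ n * (C ^ m₁ * C ^ m₂)) := by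
          have hxC : cx ≤ C := le_max_left _ _
          have hyC : cy ≤ C := le_max_right _ _
          gcongr
      _ = 2 ^ n * (1 + ρ) ^ (n + m₁ + m₂) * (2 * θ₁ * C) ^ (n + m₁ + m₂) := by
          rw [← two_mul, show 2 * (1 + ρ) * θ₁ = (1 + ρ) * (2 * θ₁) by ring, mul_pow (1 + ρ),
            mul_pow (2 * θ₁), mul_pow 2 C]
          ring
      _ ≤ _ := by
          gcongr
          · linarith
          · omega
  exact ⟨summable_of_sum_le (fun _ => norm_nonneg _) hbound,
    Real.tsum_le_of_sum_le (fun _ => norm_nonneg _) hbound⟩
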